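/- Let N ≥ 4 be an integer, let m ≥ 2, let p₁, …, p_m be distinct partitions of [k], and suppose ξ = ∑_{i=1}^m α_i ξ_{p_i} is nonzero. Suppose that for each j ∈ {1, …, m} there exists a crossing κ^j ∈ (⋂_{i ≠ j} cr(p_i)) ∖ cr(p_j). Then ⟨NC, ξ⟩ = P (equality of families meaning equality of each subspace C(k',ℓ')). -/

import Mathlib

open scoped Classical

/-- The block relation of a finite partition of `Fin n` (partition of `[n]`):
`x ∼_p y` iff `x` and `y` lie in the same block of `p`. -/
def PartRel {n : ℕ} (p : Finpartition (Finset.univ : Finset (Fin n))) (x y : Fin n) : Prop :=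
  ∃ B ∈ p.parts, x ∈ B ∧ y ∈ B

/-- `κ` is a crossing of the relation `r`: `κ = {a,b,c,d}` with `a < b < c < d`,
`r a c`, `r b d`, and `¬ r a b`. -/
def IsCross {n : ℕ} (r : Fin n → Fin n → Prop) (κ : Finset (Fin n)) : Prop :=
  ∃ a b c d : Fin n, a < b ∧ b < c ∧ c < d ∧ κ = {a, b, c, d} ∧ r a c ∧ r b d ∧ ¬ r a b

/-- `cr p`: the set of crossings of the partition `p`. -/
def cr {n : ℕ} (p : Finpartition (Finset.univ : Finset (Fin n))) : Set (Finset (Fin n)) :=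
  {κ | IsCross (PartRel p) κ}


/-- `crossers p` (`χ(p)`): the union of all crossings of `p`. -/
def crossers {n : ℕ} (p : Finpartition (Finset.univ : Finset (Fin n))) : Set (Fin n) :=
  {x | ∃ κ ∈ cr p, x ∈ κ}

/-- The vector `ξ_p ∈ (ℂ^N)^{⊗k}`, identified with `(Fin k → Fin N) → ℂ`:
its coordinate at `i` is `1` if `i` is constant on every block of `p`, else `0`. -/
noncomputable def xi (N : ℕ) {k : ℕ} (p : Finpartition (Finset.univ : Finset (Fin k))) :
    (Fin k → Fin N) → ℂ :=
  fun i => if ∀ x y, PartRel p x y → i x = i y then 1 else 0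

/-- The span of the noncrossing-partition vectors `ξ_p`, `p ∈ NC(k)`. -/
noncomputable def ncSpan (N k : ℕ) : Submodule ℂ ((Fin k → Fin N) → ℂ) :=
  Submodule.span ℂ
    {v | ∃ p : Finpartition (Finset.univ : Finset (Fin k)), cr p = ∅ ∧ v = xi N p}

/-- The span of the crossing-partition vectors `ξ_p`, `p ∈ CR(k)`. -/
noncomputable def crSpan (N k : ℕ) : Submodule ℂ ((Fin k → Fin N) → ℂ) :=
  Submodule.span ℂ
    {v | ∃ p : Finpartition (Finset.univ : Finset (Fin k)), (cr p).Nonempty ∧ v = xi N p}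

/-- The span of all partition vectors `ξ_p`, `p ∈ P(k)`. -/
noncomputable def allSpan (N k : ℕ) : Submodule ℂ ((Fin k → Fin N) → ℂ) :=
  Submodule.span ℂ
    {v | ∃ p : Finpartition (Finset.univ : Finset (Fin k)), v = xi N p}

/-- Linear maps `(ℂ^N)^{⊗k} → (ℂ^N)^{⊗ℓ}`, as matrices with rows indexed by
lower index tuples and columns by upper index tuples. -/
abbrev Mat (N k ℓ : ℕ) := Matrix (Fin ℓ → Fin N) (Fin k → Fin N) ℂ

/-- The tensor product of two such linear maps. -/
def tensorMat {N k ℓ k' ℓ' : ℕ} (S : Mat N k ℓ) (T : Mat N k' ℓ') :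
    Mat N (k + k') (ℓ + ℓ') :=
  fun i j =>
    S (fun a => i (Fin.castAdd ℓ' a)) (fun b => j (Fin.castAdd k' b)) *
      T (fun a => i (Fin.natAdd ℓ a)) (fun b => j (Fin.natAdd k b))

/-- The cup: the map `(ℂ^N)^{⊗2} → ℂ` sending `e_i ⊗ e_j` to `δ_{ij}`. -/
def cupMat (N : ℕ) : Mat N 2 0 := fun _ j => if j 0 = j 1 then 1 else 0

/-- A Tannaka–Krein dual at parameter `N`: a family of subspaces
`C k ℓ ⊆ Hom((ℂ^N)^{⊗k}, (ℂ^N)^{⊗ℓ})` closed under tensor products, composition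
and adjoints, containing the identity of `ℂ^N` and the cup. -/
structure TKDual (N : ℕ) where
  C : ∀ k ℓ : ℕ, Submodule ℂ (Mat N k ℓ)
  tensor_mem : ∀ {k ℓ k' ℓ' : ℕ} {S : Mat N k ℓ} {T : Mat N k' ℓ'},
    S ∈ C k ℓ → T ∈ C k' ℓ' → tensorMat S T ∈ C (k + k') (ℓ + ℓ')
  comp_mem : ∀ {k ℓ r : ℕ} {S : Mat N ℓ r} {T : Mat N k ℓ},
    S ∈ C ℓ r → T ∈ C k ℓ → S * T ∈ C k r
  adj_mem : ∀ {k ℓ : ℕ} {T : Mat N k ℓ}, T ∈ C k ℓ → T.conjTranspose ∈ C ℓ k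
  id_mem : (1 : Matrix (Fin 1 → Fin N) (Fin 1 → Fin N) ℂ) ∈ C 1 1
  cup_mem : cupMat N ∈ C 2 0

/-- The involution of `Fin (k + ℓ)` fixing the first `k` (upper) points and
reversing the order of the last `ℓ` (lower) points. -/
def lowerRev (k ℓ : ℕ) : Fin (k + ℓ) → Fin (k + ℓ) :=
  Fin.append (fun a : Fin k => Fin.castAdd ℓ a) (fun a : Fin ℓ => Fin.natAdd k a.rev)

/-- A partition of `[k + ℓ]` (first `k` points upper, last `ℓ` points lower) is
noncrossing when the partition obtained by reversing the order of the lower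
points has no crossing. -/
def IsNCPart {k ℓ : ℕ} (p : Finpartition (Finset.univ : Finset (Fin (k + ℓ)))) : Prop :=
  ∀ κ, ¬ IsCross (fun x y => PartRel p (lowerRev k ℓ x) (lowerRev k ℓ y)) κ

/-- The linear map `T_p : (ℂ^N)^{⊗k} → (ℂ^N)^{⊗ℓ}` of a partition `p` of `[k + ℓ]`:
its entry at (lower tuple `i`, upper tuple `j`) is `1` if the labelling of the points
of `p` by `j` on the upper points and `i` on the lower points is constant on each
block of `p`, and `0` otherwise. -/
noncomputable def Tmat (N : ℕ) (k ℓ : ℕ)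
    (p : Finpartition (Finset.univ : Finset (Fin (k + ℓ)))) : Mat N k ℓ :=
  fun i j => if ∀ x y, PartRel p x y → Fin.append j i x = Fin.append j i y then 1 else 0

/-- The family `P(k,ℓ) = span{T_p : p a partition of [k+ℓ]}`. -/
noncomputable def Pfam (N k ℓ : ℕ) : Submodule ℂ (Mat N k ℓ) :=
  Submodule.span ℂ (Set.range (Tmat N k ℓ))

/-- The family `NC(k,ℓ) = span{T_p : p a noncrossing partition of [k+ℓ]}`. -/
noncomputable def NCfam (N k ℓ : ℕ) : Submodule ℂ (Mat N k ℓ) :=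
  Submodule.span ℂ {T | ∃ p, IsNCPart p ∧ T = Tmat N k ℓ p}

/-- A vector in `(ℂ^N)^{⊗k}` viewed as a linear map `(ℂ^N)^{⊗0} → (ℂ^N)^{⊗k}`. -/
def vecMat {N k : ℕ} (v : (Fin k → Fin N) → ℂ) : Mat N 0 k := fun i _ => v i

/-- `⟨NC, ξ⟩`: the smallest Tannaka–Krein dual containing all of `NC` together with
the vector `ξ ∈ (ℂ^N)^{⊗k}` (in degree `(0,k)`), i.e. the intersection of all such. -/
noncomputable def genNCxi (N : ℕ) {k : ℕ} (ξ : (Fin k → Fin N) → ℂ) (k' ℓ' : ℕ) :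
    Submodule ℂ (Mat N k' ℓ') :=
  ⨅ (C : TKDual N) (_ : ∀ a b, NCfam N a b ≤ C.C a b) (_ : vecMat ξ ∈ C.C 0 k),
    C.C k' ℓ'

section PartitionRelations

variable {n : ℕ}

theorem partRel_equivalence (p : Finpartition (Finset.univ : Finset (Fin n))) :
    Equivalence (PartRel p) where
  refl x := by
    obtain ⟨B, hB, hx⟩ := p.exists_mem (Finset.mem_univ x)
    exact ⟨B, hB, hx, hx⟩
  symm := fun ⟨B, hB, hx, hy⟩ => ⟨B, hB, hy, hx⟩
  trans := by
    rintro x y z ⟨B, hB, hx, hy⟩ ⟨B', hB', hy', hz⟩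
    obtain rfl := p.eq_of_mem_parts hB hB' hy hy'
    exact ⟨B, hB, hx, hz⟩

theorem exists_partRel_iff (s : Setoid (Fin n)) :
    ∃ p : Finpartition (Finset.univ : Finset (Fin n)), ∀ x y, PartRel p x y ↔ s x y := by
  refine ⟨Finpartition.ofSetoid s, fun x y => ?_⟩
  rw [← Finpartition.mem_part_ofSetoid_iff_rel]
  constructor
  · rintro ⟨B, hB, hx, hy⟩
    rwa [Finpartition.part_eq_of_mem _ hB hx]
  · intro h
    exact ⟨_, (Finpartition.part_mem _).2 (Finset.mem_univ x),
      Finpartition.mem_part _ (Finset.mem_univ x), h⟩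

/-- Constancy along an arbitrary relation is constancy on the blocks of the partition that the
relation generates. -/
theorem exists_xi_eq_ite (N : ℕ) (r : Fin n → Fin n → Prop) :
    ∃ p : Finpartition (Finset.univ : Finset (Fin n)),
      xi N p = fun i => if ∀ x y, r x y → i x = i y then 1 else 0 := by
  obtain ⟨p, hp⟩ := exists_partRel_iff (Relation.EqvGen.setoid r)
  refine ⟨p, funext fun i => if_congr ?_ rfl rfl⟩
  simp only [hp]
  constructor
  · exact fun h x y hxy => h x y (Relation.EqvGen.rel _ _ hxy)
  · intro h x y hxy
    exact Setoid.eqvGen_le (s := Setoid.ker i) h hxy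

/-- Every partition is the partition into level sets of some labelling. -/
theorem exists_label (p : Finpartition (Finset.univ : Finset (Fin n))) :
    ∃ (M : ℕ) (h : Fin n → Fin M), Function.Surjective h ∧ ∀ x y, PartRel p x y ↔ h x = h y := by
  let s : Setoid (Fin n) := ⟨PartRel p, partRel_equivalence p⟩
  obtain ⟨M, ⟨e⟩⟩ := Finite.exists_equiv_fin (Quotient s)
  refine ⟨M, fun x => e ⟦x⟧, e.surjective.comp Quotient.mk_surjective, fun x y => ?_⟩
  rw [e.apply_eq_iff_eq, Quotient.eq]
  rfl

theorem strictMono_vec_four {α : Type*} [Preorder α] {a b c d : α} (hab : a < b) (hbc : b < c)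
    (hcd : c < d) : StrictMono ![a, b, c, d] := by
  rw [Fin.strictMono_iff_lt_succ]
  intro i
  fin_cases i
  exacts [hab, hbc, hcd]

/-- The sorted elements of a four-element set decide whether it is a crossing. -/
theorem isCross_iff {r : Fin n → Fin n → Prop} {a b c d : Fin n} (hab : a < b) (hbc : b < c)
    (hcd : c < d) : IsCross r {a, b, c, d} ↔ r a c ∧ r b d ∧ ¬ r a b := by
  refine ⟨?_, fun h => ⟨a, b, c, d, hab, hbc, hcd, rfl, h⟩⟩
  rintro ⟨a', b', c', d', hab', hbc', hcd', hκ, h⟩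
  have hr : ∀ a b c d : Fin n, Set.range ![a, b, c, d] = (({a, b, c, d} : Finset (Fin n)) : Set _) :=
    fun a b c d => by
      ext x
      simp only [Matrix.range_cons, Matrix.range_empty]
      simp
      tauto
  have hrange : Set.range ![a, b, c, d] = Set.range ![a', b', c', d'] := by rw [hr, hr, hκ]
  have heq := ((strictMono_vec_four hab hbc hcd).range_inj
    (strictMono_vec_four hab' hbc' hcd')).1 hrange
  obtain rfl : a = a' := congrFun heq 0
  obtain rfl : b = b' := congrFun heq 1
  obtain rfl : c = c' := congrFun heq 2
  obtain rfl : d = d' := congrFun heq 3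
  exact h

end PartitionRelations

section LevelSets

/-- The matrix of the partition of the `k + ℓ` points into the level sets of `h`. -/
noncomputable def levelMat (N k ℓ : ℕ) {L : Type*} (h : Fin (k + ℓ) → L) : Mat N k ℓ :=
  fun i j => if ∀ x y, h x = h y → Fin.append j i x = Fin.append j i y then 1 else 0

theorem levelMat_apply_eq_ite {N k ℓ : ℕ} {L : Type*} {h : Fin (k + ℓ) → L} {i j} {P : Prop}
    [Decidable P] (hP : (∀ x y, h x = h y → Fin.append j i x = Fin.append j i y) ↔ P) :
    levelMat N k ℓ h i j = if P then 1 else 0 := by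
  rw [levelMat]
  by_cases hp : P
  · rw [if_pos hp, if_pos (hP.2 hp)]
  · rw [if_neg hp, if_neg (mt hP.1 hp)]

theorem exists_Tmat_eq_levelMat (N : ℕ) {k ℓ : ℕ} {L : Type*} (h : Fin (k + ℓ) → L) :
    ∃ p, (∀ x y, PartRel p x y ↔ h x = h y) ∧ Tmat N k ℓ p = levelMat N k ℓ h := by
  obtain ⟨p, hp⟩ := exists_partRel_iff (Setoid.ker h)
  refine ⟨p, hp, ?_⟩
  ext i j
  exact if_congr (by simp only [hp]; rfl) rfl rfl

/-- If the labels, read in the cyclic order of the points, have no strict interior minimum, then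
the partition into level sets is noncrossing. -/
theorem levelMat_mem_NCfam {N k ℓ : ℕ} {L : Type*} [LinearOrder L] {h : Fin (k + ℓ) → L}
    (hq : ∀ x y z, x < y → y < z →
      min (h (lowerRev k ℓ x)) (h (lowerRev k ℓ z)) ≤ h (lowerRev k ℓ y)) :
    levelMat N k ℓ h ∈ NCfam N k ℓ := by
  obtain ⟨p, hp, hT⟩ := exists_Tmat_eq_levelMat N h
  refine Submodule.subset_span ⟨p, ?_, hT.symm⟩
  rintro κ ⟨a, b, c, d, hab, hbc, hcd, -, hac, hbd, hnab⟩
  change ¬ PartRel p _ _ at hnab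
  rw [hp] at hac hbd hnab
  have h1 := hq a b c hab hbc
  have h2 := hq b c d hbc hcd
  rw [← hac, min_self] at h1
  rw [← hbd, min_self, ← hac] at h2
  exact hnab (le_antisymm h1 h2)

theorem levelMat_append_mem_NCfam {N k ℓ : ℕ} {L : Type*} [LinearOrder L]
    {f : Fin k → L} {g : Fin ℓ → L} (hf : Monotone f) (hg : Monotone g) :
    levelMat N k ℓ (Fin.append f g) ∈ NCfam N k ℓ := by
  refine levelMat_mem_NCfam fun x y z hxy hyz => ?_
  induction y using Fin.addCases with
  | left b =>
    induction x using Fin.addCases with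
    | left a =>
      refine (min_le_left _ _).trans ?_
      simpa [lowerRev] using hf (show a ≤ b from hxy.le)
    | right a =>
      simp only [Fin.lt_def, Fin.val_natAdd, Fin.val_castAdd] at hxy
      omega
  | right b =>
    induction z using Fin.addCases with
    | left c =>
      simp only [Fin.lt_def, Fin.val_natAdd, Fin.val_castAdd] at hyz
      omega
    | right c =>
      refine (min_le_right _ _).trans ?_
      have hbc : b ≤ c := by
        simp only [Fin.lt_def, Fin.val_natAdd] at hyz
        exact Fin.le_def.2 (by omega)
      simpa [lowerRev] using hg (Fin.rev_le_rev.2 hbc)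

end LevelSets

section Symmetric

/-- The matrices invariant under relabelling the basis vectors by permutations of `Fin N`. -/
def symMat (N k ℓ : ℕ) : Submodule ℂ (Mat N k ℓ) where
  carrier := {M | ∀ (σ : Equiv.Perm (Fin N)) i j, M (σ ∘ i) (σ ∘ j) = M i j}
  add_mem' hS hT σ i j := by simp [hS σ i j, hT σ i j]
  zero_mem' _ _ _ := rfl
  smul_mem' c T hT σ i j := by simp [hT σ i j]

/-- The Tannaka–Krein dual of the invariants of the symmetric group. -/
def symDual (N : ℕ) : TKDual N where
  C := symMat N
  tensor_mem hS hT σ i j := congrArg₂ (· * ·) (hS σ _ _) (hT σ _ _)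
  comp_mem {k ℓ r S T} hS hT σ i j := by
    rw [Matrix.mul_apply, Matrix.mul_apply,
      ← (Equiv.arrowCongr (Equiv.refl (Fin ℓ)) σ).sum_comp]
    exact Finset.sum_congr rfl fun z _ => congrArg₂ (· * ·) (hS σ _ _) (hT σ _ _)
  adj_mem hT σ i j := congrArg star (hT σ _ _)
  id_mem σ i j := by simp [Matrix.one_apply, σ.injective.comp_left.eq_iff]
  cup_mem σ i j := by simp [cupMat]

theorem exists_perm_comp_eq {N n : ℕ} {f g : Fin n → Fin N}
    (h : ∀ x y, f x = f y ↔ g x = g y) : ∃ σ : Equiv.Perm (Fin N), σ ∘ f = g := by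
  have hk : Setoid.ker f = Setoid.ker g := Setoid.ext h
  let e : {x // x ∈ Set.range f} ≃ {x // x ∈ Set.range g} :=
    (Setoid.quotientKerEquivRange f).symm.trans
      ((Quotient.congrRight fun x y => h x y).trans (Setoid.quotientKerEquivRange g))
  refine ⟨e.extendSubtype, funext fun x => ?_⟩
  have hx : (Setoid.quotientKerEquivRange f).symm ⟨f x, x, rfl⟩ = Quotient.mk _ x := by
    rw [Equiv.symm_apply_eq]
    rfl
  rw [Function.comp_apply, Equiv.extendSubtype_apply_of_mem e _ ⟨x, rfl⟩]
  simp only [e, Equiv.trans_apply, hx]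
  rfl

/-- The span of the partition vectors is closed under pointwise multiplication. -/
theorem mul_mem_allSpan {N n : ℕ} {v w : (Fin n → Fin N) → ℂ}
    (hv : v ∈ allSpan N n) (hw : w ∈ allSpan N n) : v * w ∈ allSpan N n := by
  have hvw := Submodule.mul_mem_mul hv hw
  rw [allSpan, Submodule.span_mul_span] at hvw
  refine Submodule.span_le.2 ?_ hvw
  rintro _ ⟨_, ⟨p, rfl⟩, _, ⟨q, rfl⟩, rfl⟩
  obtain ⟨s, hs⟩ := exists_xi_eq_ite N fun x y => PartRel p x y ∨ PartRel q x y
  refine Submodule.subset_span ⟨s, ?_⟩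
  rw [hs]
  funext i
  simp only [xi, Pi.mul_apply, or_imp, forall_and, ← ite_and, mul_ite, mul_one, mul_zero]
  exact if_congr and_comm rfl rfl

theorem one_mem_allSpan (N n : ℕ) : (1 : (Fin n → Fin N) → ℂ) ∈ allSpan N n := by
  obtain ⟨s, hs⟩ := exists_xi_eq_ite (n := n) N fun _ _ => False
  refine Submodule.subset_span ⟨s, ?_⟩
  rw [hs]
  funext i
  simp

theorem prod_mem_allSpan {N n : ℕ} {ι : Type*} (s : Finset ι) (v : ι → (Fin n → Fin N) → ℂ)
    (hv : ∀ a ∈ s, v a ∈ allSpan N n) : ∏ a ∈ s, v a ∈ allSpan N n :=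
  Finset.prod_induction v (· ∈ allSpan N n) (fun _ _ => mul_mem_allSpan) (one_mem_allSpan N n) hv

theorem ite_ker_mem_allSpan {N n : ℕ} (f : Fin n → Fin N) :
    (fun i => if ∀ x y, i x = i y ↔ f x = f y then 1 else 0) ∈ allSpan N n := by
  have he : ∀ x y, (fun i : Fin n → Fin N => if i x = i y then (1 : ℂ) else 0) ∈
      allSpan N n := by
    intro x y
    obtain ⟨s, hs⟩ := exists_xi_eq_ite (n := n) N fun a b => a = x ∧ b = y
    refine Submodule.subset_span ⟨s, ?_⟩
    rw [hs]
    funext i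
    simp
  have hprod := prod_mem_allSpan (Finset.univ : Finset (Fin n × Fin n))
    (fun a => if f a.1 = f a.2 then fun i => if i a.1 = i a.2 then 1 else 0
      else 1 - fun i => if i a.1 = i a.2 then 1 else 0) (by
    intro a _
    split_ifs
    · exact he _ _
    · exact sub_mem (one_mem_allSpan N n) (he _ _))
  convert hprod using 1
  funext i
  rw [Finset.prod_apply]
  have hfac : ∀ a : Fin n × Fin n,
      (if f a.1 = f a.2 then (fun i : Fin n → Fin N => if i a.1 = i a.2 then (1 : ℂ) else 0)
        else 1 - fun i => if i a.1 = i a.2 then 1 else 0) i =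
      if (i a.1 = i a.2 ↔ f a.1 = f a.2) then 1 else 0 := by
    intro a
    by_cases h1 : f a.1 = f a.2 <;> by_cases h2 : i a.1 = i a.2 <;> simp [h1, h2]
  simp only [hfac, Finset.prod_ite_zero, Finset.mem_univ, true_imp_iff, Finset.prod_const_one,
    Prod.forall]

theorem mem_allSpan_of_invariant {N n : ℕ} {v : (Fin n → Fin N) → ℂ}
    (hv : ∀ (σ : Equiv.Perm (Fin N)) i, v (σ ∘ i) = v i) : v ∈ allSpan N n := by
  let K : (Fin n → Fin N) → Finset (Fin n → Fin N) := fun f =>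
    Finset.univ.filter fun i => ∀ x y, i x = i y ↔ f x = f y
  have hsum : v = ∑ f, (v f * ((K f).card : ℂ)⁻¹) •
      fun i => if ∀ x y, i x = i y ↔ f x = f y then 1 else 0 := by
    funext i
    have hterm : ∀ f, (v f * ((K f).card : ℂ)⁻¹) *
        (if ∀ x y, i x = i y ↔ f x = f y then 1 else 0) =
        if f ∈ K i then v i * ((K i).card : ℂ)⁻¹ else 0 := by
      intro f
      by_cases h : ∀ x y, i x = i y ↔ f x = f y
      · have hK : K f = K i := by simp only [K, h]
        obtain ⟨σ, rfl⟩ := exists_perm_comp_eq h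
        have hm : σ ∘ i ∈ K i := by simp [K]
        rw [if_pos h, if_pos hm, hK, hv, mul_one]
      · rw [if_neg h, if_neg (by simpa [K, iff_comm] using h), mul_zero]
    have hi : ((K i).card : ℂ) ≠ 0 :=
      Nat.cast_ne_zero.2 (Finset.card_ne_zero_of_mem (a := i) (by simp [K]))
    simp only [Finset.sum_apply, Pi.smul_apply, smul_eq_mul, hterm, Finset.sum_ite_mem,
      Finset.univ_inter, Finset.sum_const, nsmul_eq_mul]
    field_simp
  rw [hsum]
  exact sum_mem fun f _ => Submodule.smul_mem _ _ (ite_ker_mem_allSpan f)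

theorem Pfam_eq_symMat (N k ℓ : ℕ) : Pfam N k ℓ = symMat N k ℓ := by
  apply le_antisymm
  · refine Submodule.span_le.2 ?_
    rintro _ ⟨p, rfl⟩ σ i j
    refine if_congr ?_ rfl rfl
    have h : Fin.append (σ ∘ j) (σ ∘ i) = σ ∘ Fin.append j i := by
      funext x
      induction x using Fin.addCases <;> simp
    simp [h]
  · intro M hM
    let φ : ((Fin (k + ℓ) → Fin N) → ℂ) →ₗ[ℂ] Mat N k ℓ :=
      { toFun := fun v i j => v (Fin.append j i)
        map_add' := fun _ _ => rfl
        map_smul' := fun _ _ => rfl }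
    let v : (Fin (k + ℓ) → Fin N) → ℂ := fun z =>
      M (fun a => z (Fin.natAdd k a)) fun b => z (Fin.castAdd ℓ b)
    have hφ : φ v = M := by
      ext i j
      change v (Fin.append j i) = M i j
      simp [v]
    have hv : v ∈ allSpan N (k + ℓ) := mem_allSpan_of_invariant fun σ z => hM σ _ _
    rw [← hφ]
    refine (Submodule.map_le_iff_le_comap.2 ?_ : (allSpan N (k + ℓ)).map φ ≤ _)
      (Submodule.mem_map_of_mem hv)
    refine Submodule.span_le.2 ?_
    rintro _ ⟨p, rfl⟩
    exact Submodule.subset_span ⟨p, rfl⟩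

end Symmetric

section Permutations

/-- The matrix permuting tensor factors by `σ`. -/
def permMat (N : ℕ) {n : ℕ} (σ : Equiv.Perm (Fin n)) : Mat N n n :=
  fun i j => if i = j ∘ σ then 1 else 0

theorem permMat_one (N n : ℕ) : permMat N (1 : Equiv.Perm (Fin n)) = 1 := by
  ext i j
  simp [permMat, Matrix.one_apply]

theorem mul_permMat_apply {N k ℓ : ℕ} (M : Mat N k ℓ) (σ : Equiv.Perm (Fin k)) (i j) :
    (M * permMat N σ) i j = M i (j ∘ σ) := by
  simp [Matrix.mul_apply, permMat]

theorem permMat_mul_apply {N k ℓ : ℕ} (M : Mat N k ℓ) (σ : Equiv.Perm (Fin ℓ)) (i j) :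
    (permMat N σ * M) i j = M (i ∘ σ.symm) j := by
  have h : ∀ z : Fin ℓ → Fin N, i = z ∘ σ ↔ i ∘ σ.symm = z := fun z =>
    (Equiv.comp_symm_eq σ z i).symm
  simp [Matrix.mul_apply, permMat, h]

theorem permMat_mul_permMat {N n : ℕ} (σ τ : Equiv.Perm (Fin n)) :
    permMat N σ * permMat N τ = permMat N (τ * σ) := by
  ext i j
  rw [mul_permMat_apply]
  rfl

variable {N : ℕ} (C : TKDual N)

theorem one_mem_of_NCfam_le (hNC : ∀ a b, NCfam N a b ≤ C.C a b) (n : ℕ) :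
    (1 : Mat N n n) ∈ C.C n n := by
  refine hNC n n ?_
  convert levelMat_append_mem_NCfam (N := N) (monotone_id (α := Fin n)) (monotone_id (α := Fin n))
    using 1
  ext i j
  rw [Matrix.one_apply]
  refine (levelMat_apply_eq_ite ⟨fun h => ?_, ?_⟩).symm
  · funext x
    simpa [-Fin.natAdd_eq_addNat] using
      h (Fin.natAdd n x) (Fin.castAdd n x) (by simp [-Fin.natAdd_eq_addNat])
  · rintro rfl x y
    induction x using Fin.addCases <;> induction y using Fin.addCases <;>
      simp +contextual [-Fin.natAdd_eq_addNat]

theorem permMat_swap_eq_tensorMat (a b : ℕ) :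
    permMat N (Equiv.swap (Fin.castAdd b (Fin.natAdd a (0 : Fin 2)))
      (Fin.castAdd b (Fin.natAdd a (1 : Fin 2)))) =
    tensorMat (tensorMat (1 : Mat N a a) (permMat N (Equiv.swap (0 : Fin 2) 1)))
      (1 : Mat N b b) := by
  ext i j
  simp only [tensorMat, permMat, Matrix.one_apply, ← ite_and, mul_ite, mul_one, mul_zero]
  refine if_congr ?_ rfl rfl
  have h0 : ∀ x : Fin a, Equiv.swap (Fin.castAdd b (Fin.natAdd a (0 : Fin 2)))
      (Fin.castAdd b (Fin.natAdd a 1)) (Fin.castAdd b (Fin.castAdd 2 x)) =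
      Fin.castAdd b (Fin.castAdd 2 x) := fun x =>
    Equiv.swap_apply_of_ne_of_ne (by simp [Fin.ext_iff]; omega) (by simp [Fin.ext_iff]; omega)
  have h2 : ∀ x : Fin b, Equiv.swap (Fin.castAdd b (Fin.natAdd a (0 : Fin 2)))
      (Fin.castAdd b (Fin.natAdd a 1)) (Fin.natAdd (a + 2) x) =
      Fin.natAdd (a + 2) x := fun x =>
    Equiv.swap_apply_of_ne_of_ne (by simp [Fin.ext_iff]; omega) (by simp [Fin.ext_iff]; omega)
  simp only [funext_iff, Function.comp_apply, Fin.forall_fin_add, Fin.forall_fin_two, h0, h2,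
    Equiv.swap_apply_left, Equiv.swap_apply_right]
  tauto

theorem permMat_mem (hNC : ∀ a b, NCfam N a b ≤ C.C a b)
    (hswap : permMat N (Equiv.swap (0 : Fin 2) 1) ∈ C.C 2 2) {n : ℕ} (σ : Equiv.Perm (Fin n)) :
    permMat N σ ∈ C.C n n := by
  have hadj : ∀ {n : ℕ} (x y : Fin n), (y : ℕ) = x + 1 → permMat N (Equiv.swap x y) ∈ C.C n n := by
    intro n x y hxy
    obtain ⟨b, hb⟩ : ∃ b, n = x + 2 + b := ⟨n - (x + 2), by omega⟩
    obtain ⟨a, ha⟩ : ∃ a, a = (x : ℕ) := ⟨_, rfl⟩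
    rw [← ha] at hb
    subst hb
    have h := C.tensor_mem (C.tensor_mem (one_mem_of_NCfam_le C hNC a) hswap)
      (one_mem_of_NCfam_le C hNC b)
    rw [← permMat_swap_eq_tensorMat] at h
    convert h using 3
    · exact Fin.ext (by simp [ha])
    · exact Fin.ext (by simp [ha, hxy])
  cases n with
  | zero =>
    rw [Subsingleton.elim σ 1, permMat_one]
    exact one_mem_of_NCfam_le C hNC 0
  | succ n =>
    have hσ : σ ∈ Submonoid.closure (Set.range fun i : Fin n => Equiv.swap i.castSucc i.succ) := by
      rw [Equiv.Perm.mclosure_swap_castSucc_succ]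
      trivial
    induction hσ using Submonoid.closure_induction with
    | mem _ h =>
      obtain ⟨i, rfl⟩ := h
      exact hadj _ _ (by simp)
    | one =>
      rw [permMat_one]
      exact one_mem_of_NCfam_le C hNC _
    | mul σ τ _ _ hσ hτ =>
      rw [← permMat_mul_permMat]
      exact C.comp_mem hτ hσ

/-- Noncrossing partitions together with the swap generate all partitions. -/
theorem Pfam_le_of_swap_mem (hNC : ∀ a b, NCfam N a b ≤ C.C a b)
    (hswap : permMat N (Equiv.swap (0 : Fin 2) 1) ∈ C.C 2 2) (k ℓ : ℕ) :
    Pfam N k ℓ ≤ C.C k ℓ := by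
  refine Submodule.span_le.2 ?_
  rintro _ ⟨p, rfl⟩
  obtain ⟨M, h, -, hp⟩ := exists_label p
  let f : Fin k → Fin M := h ∘ Fin.castAdd ℓ
  let g : Fin ℓ → Fin M := h ∘ Fin.natAdd k
  let σ := Tuple.sort f
  let τ := Tuple.sort g
  have hM := hNC k ℓ (levelMat_append_mem_NCfam (Tuple.monotone_sort f) (Tuple.monotone_sort g))
  have hc := C.comp_mem (C.comp_mem (permMat_mem C hNC hswap τ.symm) hM)
    (permMat_mem C hNC hswap σ)
  have hT : Tmat N k ℓ p = permMat N τ.symm *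
      levelMat N k ℓ (Fin.append (f ∘ σ) (g ∘ τ)) * permMat N σ := by
    ext i j
    rw [mul_permMat_apply, permMat_mul_apply]
    refine (levelMat_apply_eq_ite ?_).symm
    let ρ : Equiv.Perm (Fin (k + ℓ)) := finSumFinEquiv.permCongr (σ.sumCongr τ)
    have hρ : ∀ {α : Type} (w : Fin (k + ℓ) → α),
        Fin.append ((w ∘ Fin.castAdd ℓ) ∘ σ) ((w ∘ Fin.natAdd k) ∘ τ) = w ∘ ρ := by
      intro α w
      funext x
      induction x using Fin.addCases <;> simp [ρ]
    have hij : Fin.append (j ∘ σ) (i ∘ τ) = Fin.append j i ∘ ρ := by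
      rw [← hρ]
      congr 1 <;> (funext x; simp)
    simp only [hp, Equiv.symm_symm, hij, f, g, hρ, Function.comp_apply]
    rw [ρ.forall_congr_left]
    simp only [Equiv.apply_symm_apply]
    exact forall_congr' fun x => ρ.forall_congr (by simp)
  rw [hT]
  exact hc

end Permutations

section Contraction

/-- The number of labellings constant on the level sets of `h` with prescribed values at the
points `s t`. -/
theorem card_constant_on_levels {N k M n : ℕ} {h : Fin k → Fin M} (hh : Function.Surjective h)
    (s : Fin n → Fin k) (u : Fin n → Fin N) :
    (Finset.univ.filter fun x : Fin k → Fin N =>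
      (∀ a b, h a = h b → x a = x b) ∧ x ∘ s = u).card =
    if ∀ t t', h (s t) = h (s t') → u t = u t'
      then N ^ (M - (Finset.univ.image (h ∘ s)).card) else 0 := by
  split_ifs with hu
  · let B := Finset.univ.image (h ∘ s)
    have hB : ∀ q ∈ B, ∃ t, h (s t) = q := fun q hq => by simpa [B] using hq
    let F : Fin M → Finset (Fin N) := fun q =>
      if hq : q ∈ B then {u (hB q hq).choose} else Finset.univ
    have himage : (Finset.univ.filter fun x : Fin k → Fin N =>
        (∀ a b, h a = h b → x a = x b) ∧ x ∘ s = u) =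
        (Fintype.piFinset F).image fun y => y ∘ h := by
      ext x
      simp only [Finset.mem_filter, Finset.mem_univ, true_and, Finset.mem_image,
        Fintype.mem_piFinset]
      constructor
      · rintro ⟨hx, rfl⟩
        refine ⟨x ∘ Function.surjInv hh, fun q => ?_, ?_⟩
        · by_cases hq : q ∈ B
          · simp only [F, dif_pos hq, Finset.mem_singleton, Function.comp_apply]
            refine hx _ _ ?_
            rw [Function.surjInv_eq hh]
            exact (hB q hq).choose_spec.symm
          · simp [F, hq]
        · funext a
          exact hx _ _ (Function.surjInv_eq hh _)
      · rintro ⟨y, hy, rfl⟩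
        refine ⟨fun a b hab => congrArg y hab, funext fun t => ?_⟩
        have hq : h (s t) ∈ B := Finset.mem_image_of_mem _ (Finset.mem_univ t)
        have hyt := hy (h (s t))
        simp only [F, dif_pos hq, Finset.mem_singleton] at hyt
        exact hyt.trans (hu _ _ (hB _ hq).choose_spec)
    have hcard : ∀ q, (F q).card = if q ∈ B then 1 else N := by
      intro q
      by_cases hq : q ∈ B <;> simp [F, hq]
    rw [himage, Finset.card_image_of_injective _ hh.injective_comp_right, Fintype.card_piFinset]
    simp only [hcard, Finset.prod_ite, Finset.prod_const_one, one_mul, Finset.prod_const]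
    congr 1
    rw [Finset.filter_not, Finset.card_sdiff_of_subset (Finset.filter_subset _ _)]
    simp only [Finset.card_univ, Fintype.card_fin, Finset.filter_univ_mem, B]
  · rw [Finset.card_eq_zero, Finset.filter_eq_empty_iff]
    rintro x - ⟨hx, rfl⟩
    exact hu fun t t' htt => hx _ _ htt

/-- The points `d, c, a, b`, as two upper points followed by two lower points. -/
def corners {k : ℕ} (a b c d : Fin k) : Fin (2 + 2) → Fin k := Fin.append ![d, c] ![a, b]

/-- Sum out all tensor factors of `v` except those at `a`, `b`, `c`, `d`, making the first two
of these the outputs and the last two, in reverse order, the inputs. -/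
def contract {N k : ℕ} (v : (Fin k → Fin N) → ℂ) (a b c d : Fin k) : Mat N 2 2 :=
  fun i j => ∑ x, v x * if x ∘ corners a b c d = Fin.append j i then 1 else 0

theorem contract_sum {N k : ℕ} {ι : Type*} [Fintype ι] (α : ι → ℂ)
    (v : ι → (Fin k → Fin N) → ℂ) (a b c d : Fin k) :
    contract (∑ i, α i • v i) a b c d = ∑ i, α i • contract (v i) a b c d := by
  ext i j
  simp only [contract, Finset.sum_apply, Pi.smul_apply, smul_eq_mul, Finset.sum_mul,
    Matrix.sum_apply, Matrix.smul_apply, Finset.mul_sum, mul_assoc]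
  exact Finset.sum_comm

theorem contract_mem {N k : ℕ} (C : TKDual N) (hNC : ∀ a b, NCfam N a b ≤ C.C a b)
    {v : (Fin k → Fin N) → ℂ} (hv : vecMat v ∈ C.C 0 k) {a b c d : Fin k} (hab : a < b)
    (hbc : b < c) (hcd : c < d) : contract v a b c d ∈ C.C 2 2 := by
  let h : Fin (k + 2 + 2) → Fin k := Fin.append (Fin.append id ![d, c]) ![a, b]
  have hQ : levelMat N (k + 2) 2 h ∈ C.C (k + 2) 2 := by
    refine hNC _ _ (levelMat_mem_NCfam fun x y z hxy hyz => ?_)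
    rcases lt_or_ge (y : ℕ) k with hy | hy
    · have hlow : ∀ (t : Fin (k + 2 + 2)) (ht : (t : ℕ) < k),
          h (lowerRev (k + 2) 2 t) = ⟨t, ht⟩ := by
        intro t ht
        change h (lowerRev (k + 2) 2 (Fin.castAdd 2 (Fin.castAdd 2 ⟨t, ht⟩))) = _
        rw [lowerRev, Fin.append_left]
        exact (Fin.append_left _ _ _).trans (Fin.append_left _ _ _)
      rw [hlow y hy, hlow x ((Fin.lt_def.1 hxy).trans hy)]
      exact (min_le_left _ _).trans hxy.le
    · have hhigh : ∀ t : Fin 4, h (lowerRev (k + 2) 2 ⟨k + t, by omega⟩) = ![d, c, b, a] t := by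
        intro t
        fin_cases t
        · change h (lowerRev (k + 2) 2 (Fin.castAdd 2 (Fin.natAdd k 0))) = d
          simp [h, lowerRev, -Fin.natAdd_eq_addNat]
        · change h (lowerRev (k + 2) 2 (Fin.castAdd 2 (Fin.natAdd k 1))) = c
          simp [h, lowerRev, -Fin.natAdd_eq_addNat]
        · change h (lowerRev (k + 2) 2 (Fin.natAdd (k + 2) 0)) = b
          simp [h, lowerRev, -Fin.natAdd_eq_addNat]
        · change h (lowerRev (k + 2) 2 (Fin.natAdd (k + 2) 1)) = a
          simp [h, lowerRev, -Fin.natAdd_eq_addNat]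
      have hdec : Antitone ![d, c, b, a] := by
        rw [Fin.antitone_iff_succ_le]
        intro t
        fin_cases t
        exacts [hcd.le, hbc.le, hab.le]
      have hpos : ∀ t : Fin (k + 2 + 2), k ≤ (t : ℕ) →
          ∃ r : Fin 4, t = ⟨k + r, by omega⟩ := fun t ht =>
        ⟨⟨t - k, by omega⟩, Fin.ext (by simp; omega)⟩
      obtain ⟨r, hr⟩ := hpos y hy
      obtain ⟨r', hr'⟩ := hpos z (hy.trans hyz.le)
      rw [hr, hr'] at hyz
      rw [hr, hr', hhigh, hhigh]
      refine (min_le_right _ _).trans (hdec ?_)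
      simp only [Fin.lt_def] at hyz
      exact Fin.le_def.2 (by omega)
  have hm := C.comp_mem hQ (C.tensor_mem hv (one_mem_of_NCfam_le C hNC 2))
  convert hm using 1
  ext i j
  rw [Matrix.mul_apply, ← (Fin.appendEquiv k 2).sum_comp, Fintype.sum_prod_type]
  refine Finset.sum_congr rfl fun x _ => ?_
  have hQx : ∀ y, levelMat N (k + 2) 2 h i (Fin.append x y) =
      if x ∘ corners a b c d = Fin.append y i then 1 else 0 := by
    intro y
    refine levelMat_apply_eq_ite ⟨fun hr => funext fun t => ?_, fun hx => ?_⟩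
    · induction t using Fin.addCases with
      | left t =>
        simpa [h, corners, -Fin.natAdd_eq_addNat] using
          hr (Fin.castAdd 2 (Fin.castAdd 2 (![d, c] t))) (Fin.castAdd 2 (Fin.natAdd k t))
            (by simp [h, -Fin.natAdd_eq_addNat])
      | right t =>
        simpa [h, corners, -Fin.natAdd_eq_addNat] using
          hr (Fin.castAdd 2 (Fin.castAdd 2 (![a, b] t))) (Fin.natAdd (k + 2) t)
            (by simp [h, -Fin.natAdd_eq_addNat])
    · have hxh : Fin.append (Fin.append x y) i = x ∘ h := by
        funext t
        induction t using Fin.addCases with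
        | left t =>
          induction t using Fin.addCases with
          | left t => simp [h]
          | right t =>
            simpa [h, corners, -Fin.natAdd_eq_addNat] using (congrFun hx (Fin.castAdd 2 t)).symm
        | right t =>
          simpa [h, corners, -Fin.natAdd_eq_addNat] using (congrFun hx (Fin.natAdd 2 t)).symm
      intro t t' htt
      rw [hxh, Function.comp_apply, Function.comp_apply, htt]
  have hj : (fun t : Fin 2 => j (Fin.natAdd 0 t)) = j := funext fun t => congrArg j (by simp)
  have hE : ∀ y, tensorMat (vecMat v) (1 : Mat N 2 2) (Fin.append x y) j =
      v x * if y = j then 1 else 0 := by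
    intro y
    simp only [tensorMat, vecMat, Matrix.one_apply, Fin.append_left, Fin.append_right]
    rw [hj]
  change _ = ∑ y, levelMat N (k + 2) 2 h i (Fin.append x y) *
    tensorMat (vecMat v) (1 : Mat N 2 2) (Fin.append x y) j
  simp only [hE, hQx, mul_ite, mul_one, mul_zero, Finset.sum_ite_eq', Finset.mem_univ, if_true]
  simp

theorem contract_xi {N k M : ℕ} {p : Finpartition (Finset.univ : Finset (Fin k))}
    {h : Fin k → Fin M} (hh : Function.Surjective h) (hp : ∀ x y, PartRel p x y ↔ h x = h y)
    (a b c d : Fin k) :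
    contract (xi N p) a b c d =
      ((N : ℂ) ^ (M - (Finset.univ.image (h ∘ corners a b c d)).card)) •
        levelMat N 2 2 (h ∘ corners a b c d) := by
  ext i j
  have hc := card_constant_on_levels hh (corners a b c d) (Fin.append j i)
  have hl : contract (xi N p) a b c d i j = ((Finset.univ.filter fun x : Fin k → Fin N =>
      (∀ a b, h a = h b → x a = x b) ∧
        x ∘ corners a b c d = Fin.append j i).card : ℂ) := by
    simp only [contract, xi, hp, Finset.card_filter, Nat.cast_sum, ← ite_and, mul_ite, mul_one,
      mul_zero, Nat.cast_ite, Nat.cast_one, Nat.cast_zero]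
    exact Finset.sum_congr rfl fun x _ => if_congr and_comm rfl rfl
  rw [hl, hc, Matrix.smul_apply, smul_eq_mul]
  have hm : levelMat N 2 2 (h ∘ corners a b c d) i j =
      if ∀ t t', h (corners a b c d t) = h (corners a b c d t') →
        Fin.append j i t = Fin.append j i t' then 1 else 0 := levelMat_apply_eq_ite Iff.rfl
  rw [hm]
  split_ifs <;> simp

theorem levelMat_eq_permMat_swap {N k : ℕ} {L : Type*} {h : Fin k → L} {a b c d : Fin k}
    (hac : h a = h c) (hbd : h b = h d) (hab : h a ≠ h b) :
    levelMat N 2 2 (h ∘ corners a b c d) = permMat N (Equiv.swap (0 : Fin 2) 1) := by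
  ext i j
  refine levelMat_apply_eq_ite ?_
  constructor
  · intro hr
    have h0 : j 0 = i 1 := hr (Fin.castAdd 2 0) (Fin.natAdd 2 1) hbd.symm
    have h1 : j 1 = i 0 := hr (Fin.castAdd 2 1) (Fin.natAdd 2 0) hac.symm
    funext t
    fin_cases t
    exacts [h1.symm, h0.symm]
  · rintro rfl
    let w : L → Fin N := fun l => if l = h a then j 1 else j 0
    have ha : w (h a) = j 1 := if_pos rfl
    have hb : w (h b) = j 0 := if_neg hab.symm
    have hw : ∀ t, Fin.append j (j ∘ Equiv.swap (0 : Fin 2) 1) t =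
        w ((h ∘ corners a b c d) t) := by
      intro t
      induction t using Fin.addCases with
      | left t =>
        fin_cases t
        exacts [((congrArg w hbd).symm.trans hb).symm, ((congrArg w hac).symm.trans ha).symm]
      | right t =>
        fin_cases t
        exacts [ha.symm, hb.symm]
    intro t t' htt
    rw [hw, hw, htt]

theorem card_image_labels_of_crossing {k M : ℕ} {h : Fin k → Fin M} {a b c d : Fin k}
    (hac : h a = h c) (hbd : h b = h d) (hab : h a ≠ h b) :
    (Finset.univ.image (h ∘ corners a b c d)).card = 2 := by
  suffices h2 : Finset.univ.image (h ∘ corners a b c d) = {h a, h b} by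
    rw [h2, Finset.card_pair hab]
  ext q
  simp only [Finset.mem_image, Finset.mem_univ, true_and, Function.comp_apply,
    Finset.mem_insert, Finset.mem_singleton, corners]
  constructor
  · rintro ⟨t, rfl⟩
    induction t using Fin.addCases with
    | left t =>
      fin_cases t
      exacts [Or.inr hbd.symm, Or.inl hac.symm]
    | right t =>
      fin_cases t
      exacts [Or.inl rfl, Or.inr rfl]
  · rintro (rfl | rfl)
    · exact ⟨Fin.natAdd 2 0, rfl⟩
    · exact ⟨Fin.natAdd 2 1, rfl⟩

theorem levelMat_mem_NCfam_of_not_crossing {N k : ℕ} {L : Type*} {h : Fin k → L}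
    {a b c d : Fin k} (hn : ¬ (h a = h c ∧ h b = h d ∧ h a ≠ h b)) :
    levelMat N 2 2 (h ∘ corners a b c d) ∈ NCfam N 2 2 := by
  obtain ⟨p, hp, hT⟩ := exists_Tmat_eq_levelMat N (h ∘ corners a b c d)
  refine Submodule.subset_span ⟨p, ?_, hT.symm⟩
  rintro κ ⟨x, y, z, w, hxy, hyz, hzw, -, hxz, hyw, hnxy⟩
  change ¬ PartRel p _ _ at hnxy
  rw [hp] at hxz hyw hnxy
  obtain ⟨hx, hy, hz, hw⟩ : (x : ℕ) = 0 ∧ (y : ℕ) = 1 ∧ (z : ℕ) = 2 ∧ (w : ℕ) = 3 := by omega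
  obtain rfl : x = 0 := Fin.ext hx
  obtain rfl : y = 1 := Fin.ext hy
  obtain rfl : z = 2 := Fin.ext hz
  obtain rfl : w = 3 := Fin.ext hw
  have hca : h c = h a := hyw
  have hdb : h d = h b := hxz
  have hdc : h d ≠ h c := hnxy
  exact hn ⟨hca.symm, hdb.symm, fun e => hdc (by rw [hdb, hca, e])⟩

end Contraction

theorem Finset.eq_zero_of_sum_erase_eq_zero {m : ℕ} (hm : 2 ≤ m) {β : Fin m → ℂ}
    (h : ∀ j, ∑ i ∈ Finset.univ.erase j, β i = 0) : β = 0 := by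
  have hβ : ∀ j, β j = ∑ i, β i := fun j => by
    rw [← Finset.add_sum_erase _ _ (Finset.mem_univ j), h, add_zero]
  have hS : ∑ i, β i = m * ∑ i, β i := by
    conv_lhs => rw [Finset.sum_congr rfl fun j _ => hβ j]
    simp
  have hm' : (m : ℂ) - 1 ≠ 0 := sub_ne_zero.2 (by exact_mod_cast (by omega : m ≠ 1))
  have h0 : ∑ i, β i = 0 := by
    refine (mul_eq_zero.1 (?_ : ((m : ℂ) - 1) * _ = 0)).resolve_left hm'
    rw [sub_mul, one_mul, ← hS, sub_self]
  funext j
  rw [hβ, h0, Pi.zero_apply]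

/-- for `N ≥ 4`, `m ≥ 2`, distinct partitions `p₁, …, p_m` of `[k]` and
nonzero `ξ = ∑ α_i ξ_{p_i}`, if for each `j` there is a crossing common to all `p_i`,
`i ≠ j`, which is not a crossing of `p_j`, then `⟨NC, ξ⟩ = P`. -/
theorem stmt15 {N k m : ℕ} (hN : 4 ≤ N) (hm : 2 ≤ m)
    (p : Fin m → Finpartition (Finset.univ : Finset (Fin k)))
    (hinj : Function.Injective p)
    (α : Fin m → ℂ)
    (ξ : (Fin k → Fin N) → ℂ) (hξ : ξ = ∑ i, α i • xi N (p i)) (hne : ξ ≠ 0)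
    (hcr : ∀ j : Fin m, ∃ κ : Finset (Fin k),
      (∀ i, i ≠ j → κ ∈ cr (p i)) ∧ κ ∉ cr (p j)) :
    ∀ k' ℓ', genNCxi N ξ k' ℓ' = Pfam N k' ℓ' := by
  intro k' ℓ'
  apply le_antisymm
  · rw [Pfam_eq_symMat]
    refine iInf_le_of_le (symDual N) (iInf_le_of_le ?_ (iInf_le_of_le ?_ le_rfl))
    · intro a b
      change NCfam N a b ≤ symMat N a b
      rw [← Pfam_eq_symMat]
      exact Submodule.span_mono (by rintro _ ⟨p, -, rfl⟩; exact ⟨p, rfl⟩)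
    · intro σ i _
      simp [vecMat, hξ, xi]
  · refine le_iInf fun C => le_iInf fun hNC => le_iInf fun hC => ?_
    refine Pfam_le_of_swap_mem C hNC ?_ k' ℓ'
    by_contra hswap
    choose M h hh hp using fun i => exists_label (p i)
    have hN0 : (N : ℂ) ≠ 0 := Nat.cast_ne_zero.2 (by omega)
    have hzero : ∀ j, ∑ i ∈ Finset.univ.erase j, α i * (N : ℂ) ^ (M i - 2) = 0 := by
      intro j
      obtain ⟨κ, hκ, hκj⟩ := hcr j
      obtain ⟨i₀, hi₀⟩ : ∃ i₀, i₀ ≠ j := by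
        have : Nontrivial (Fin m) := Fin.nontrivial_iff_two_le.2 hm
        exact exists_ne j
      obtain ⟨a, b, c, d, hab, hbc, hcd, rfl, -⟩ := hκ i₀ hi₀
      simp only [cr, Set.mem_ofPred_eq, isCross_iff hab hbc hcd, hp] at hκ hκj
      have hm := contract_mem C hNC hC hab hbc hcd
      rw [hξ, contract_sum, ← Finset.add_sum_erase _ _ (Finset.mem_univ j),
        Finset.sum_congr (g := fun i => (α i * (N : ℂ) ^ (M i - 2)) •
          permMat N (Equiv.swap (0 : Fin 2) 1)) rfl, ← Finset.sum_smul] at hm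
      · rw [Submodule.add_mem_iff_right] at hm
        · by_contra hne0
          exact hswap ((Submodule.smul_mem_iff _ hne0).1 hm)
        · rw [contract_xi (hh j) (hp j)]
          exact Submodule.smul_mem _ _ (Submodule.smul_mem _ _
            (hNC _ _ (levelMat_mem_NCfam_of_not_crossing hκj)))
      · intro i hi
        obtain ⟨hac, hbd, hnab⟩ := hκ i (Finset.ne_of_mem_erase hi)
        rw [contract_xi (hh i) (hp i), levelMat_eq_permMat_swap hac hbd hnab,
          card_image_labels_of_crossing hac hbd hnab, smul_smul]
    have hβ := Finset.eq_zero_of_sum_erase_eq_zero hm hzero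
    refine hne (hξ.trans (Finset.sum_eq_zero fun i _ => ?_))
    have hαi : α i = 0 := (mul_eq_zero.1 (congrFun hβ i)).resolve_right (pow_ne_zero _ hN0)
    rw [hαi, zero_smul]
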